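/- Let M be a complex vector space with a monodromic structure of rank r, i.e. a rank-r Weyl system t_1,…,t_r, ∂_1,…,∂_r together with a direct sum decomposition M = ⊕_{χ∈ℚ} M^χ with t_i(M^χ) ⊆ M^{χ+1}, ∂_i(M^χ) ⊆ M^{χ−1}, and θ − χ + r locally nilpotent on M^χ for every χ, where θ := Σ_{i=1}^r t_i∘∂_i. Then for every rational number χ ≠ 0 both of the following Koszul-type complexes are exact: (a) the complex with ℓ-th term M^{χ+ℓ} ⊗ Λ^ℓ(ℂ^r) (ℓ = 0,…,r) and differential m⊗ω ↦ Σ_{i=1}^r t_i(m)⊗(e_i∧ω); (b) the complex with ℓ-th term M^{χ+r−ℓ} ⊗ Λ^ℓ(ℂ^r) (ℓ = 0,…,r) and differential m⊗ω ↦ Σ_{i=1}^r ∂_i(m)⊗(e_i∧ω). -/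

import Mathlib

open TensorProduct

noncomputable section

/-- Wedging on the left with a fixed vector `v`, as a linear map `⋀^ℓ M → ⋀^(ℓ+1) M`,
`ω ↦ v ∧ ω`. -/
def wedgeMap (R : Type*) [CommRing R] {M : Type*} [AddCommGroup M] [Module R M]
    (v : M) (ℓ : ℕ) : ⋀[R]^ℓ M →ₗ[R] ⋀[R]^(ℓ+1) M :=
  LinearMap.codRestrict _
    ((LinearMap.mulLeft R (ExteriorAlgebra.ι R v)).comp (Submodule.subtype _))
    (fun ω => by
      have h : ExteriorAlgebra.ι R v * (ω : ExteriorAlgebra R M) ∈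
          (LinearMap.range (ExteriorAlgebra.ι R : M →ₗ[R] ExteriorAlgebra R M)) ^ (ℓ + 1) := by
        rw [pow_succ']
        exact Submodule.mul_mem_mul (LinearMap.mem_range_self _ v) ω.2
      simpa using h)

open Module.End in
/-- If a linear map `ι` intertwines `f` and `g` and `ι` is injective, generalized eigenvectors of
`g` in the range of `ι` come from generalized eigenvectors of `f`. -/
lemma mem_maxGenEigenspace_of_intertwine {R V W : Type*} [CommRing R] [AddCommGroup V] [Module R V]
    [AddCommGroup W] [Module R W] {f : Module.End R V} {g : Module.End R W} {ι : V →ₗ[R] W}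
    (hι : Function.Injective ι) (h : ∀ x, ι (f x) = g (ι x)) {c : R} {x : V}
    (hx : ι x ∈ maxGenEigenspace g c) : x ∈ maxGenEigenspace f c := by
  rw [mem_maxGenEigenspace] at hx ⊢
  obtain ⟨k, hk⟩ := hx
  refine ⟨k, hι ?_⟩
  rw [map_zero, ← hk]
  clear hk
  induction k generalizing x with
  | zero => simp
  | succ k ih => rw [pow_succ, pow_succ, Module.End.mul_apply, Module.End.mul_apply, ih]; simp [h]

open Module.End in
/-- Shifting an endomorphism by a scalar shifts its generalized eigenvalues. -/
lemma mem_maxGenEigenspace_add_smul_one {R V : Type*} [CommRing R] [AddCommGroup V] [Module R V]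
    {f g : Module.End R V} {a b c : R} (hg : g = f + a • 1) (hc : c = b + a) {x : V} :
    x ∈ maxGenEigenspace g c ↔ x ∈ maxGenEigenspace f b := by
  have : g - c • 1 = f - b • 1 := by rw [hg, hc, add_smul]; abel
  simp only [mem_maxGenEigenspace, this]

open Module.End in
/-- If every vector is a generalized eigenvector of `f`, the same holds for `f ⊗ id`. -/
lemma mem_maxGenEigenspace_rTensor {R V W : Type*} [CommRing R] [AddCommGroup V] [Module R V]
    [AddCommGroup W] [Module R W] {f : Module.End R V} {c : R}
    (h : ∀ x, x ∈ maxGenEigenspace f c) (z : V ⊗[R] W) :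
    z ∈ maxGenEigenspace (f.rTensor W) c := by
  induction z with
  | zero => exact zero_mem _
  | add x y hx hy => exact add_mem hx hy
  | tmul x w =>
    obtain ⟨k, hk⟩ := (mem_maxGenEigenspace f c x).1 (h x)
    refine (mem_maxGenEigenspace _ c _).2 ⟨k, ?_⟩
    have : f.rTensor W - c • 1 = (f - c • 1).rTensor W := by
      rw [LinearMap.rTensor_sub, LinearMap.rTensor_smul]
      congr 2
      exact (LinearMap.rTensor_id W V).symm
    rw [this, LinearMap.rTensor_pow, LinearMap.rTensor_tmul, hk, zero_tmul]

open Module.End in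
/-- A complex with a contracting homotopy up to an operator whose only generalized eigenvalue is
`c ≠ 0` is exact. -/
lemma exact_of_homotopy {F : Type*} [Field F] {K : ℕ → Type*} [∀ n, AddCommGroup (K n)]
    [∀ n, Module F (K n)] (δ : ∀ n, K n →ₗ[F] K (n + 1)) (h : ∀ n, K (n + 1) →ₗ[F] K n)
    (hδ : ∀ n x, δ (n + 1) (δ n x) = 0) {c : F} (hc : c ≠ 0)
    (h0 : ∀ x, x ∈ maxGenEigenspace (h 0 ∘ₗ δ 0 : Module.End F (K 0)) c)
    (hs : ∀ n x, x ∈ maxGenEigenspace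
      (h (n + 1) ∘ₗ δ (n + 1) + δ n ∘ₗ h n : Module.End F (K (n + 1))) c) :
    LinearMap.ker (δ 0) = ⊥ ∧ ∀ n, LinearMap.ker (δ (n + 1)) = LinearMap.range (δ n) := by
  refine ⟨(Submodule.eq_bot_iff _).2 fun x hx => ?_, fun n => le_antisymm (fun x hx => ?_) ?_⟩
  · obtain ⟨k, hk⟩ := (mem_maxGenEigenspace _ _ _).1 (h0 x)
    rw [LinearMap.mem_ker] at hx
    induction k generalizing x with
    | zero => simpa using hk
    | succ k ih =>
      rw [pow_succ, Module.End.mul_apply] at hk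
      have := ih _ (by simp [hx]) hk
      simpa [hx, hc] using this
  · obtain ⟨k, hk⟩ := (mem_maxGenEigenspace _ _ _).1 (hs n x)
    rw [LinearMap.mem_ker] at hx
    induction k generalizing x with
    | zero =>
      obtain rfl : x = 0 := by simpa using hk
      exact zero_mem _
    | succ k ih =>
      rw [pow_succ, Module.End.mul_apply] at hk
      have := ih _ (by simp [hx, hδ]) hk
      simp only [LinearMap.sub_apply, LinearMap.add_apply, LinearMap.comp_apply, hx, map_zero,
        zero_add, LinearMap.smul_apply, Module.End.one_apply] at this
      have hcx := (Submodule.sub_mem_iff_right _ (LinearMap.mem_range_self (δ n) (h n x))).1 this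
      exact (Submodule.smul_mem_iff _ hc).1 hcx
  · rintro _ ⟨y, rfl⟩
    exact hδ n y

section Contraction

variable (R : Type*) [CommRing R] {V : Type*} [AddCommGroup V] [Module R V]

lemma contractLeft_mem_exteriorPower (φ : Module.Dual R V) (n : ℕ) (x : ExteriorAlgebra R V)
    (hx : x ∈ ⋀[R]^(n + 1) V) :
    CliffordAlgebra.contractLeft (Q := (0 : QuadraticForm R V)) φ x ∈ ⋀[R]^n V := by
  rw [ExteriorAlgebra.exteriorPower, pow_succ'] at hx
  induction hx using Submodule.mul_induction_on' with
  | add x _ y _ hx hy => rw [map_add]; exact add_mem hx hy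
  | mem_mul_mem m hm y hy =>
    obtain ⟨v, rfl⟩ := hm
    have key : CliffordAlgebra.contractLeft (Q := (0 : QuadraticForm R V)) φ
        (ExteriorAlgebra.ι R v * y) = φ v • y - ExteriorAlgebra.ι R v *
          CliffordAlgebra.contractLeft (Q := (0 : QuadraticForm R V)) φ y :=
      CliffordAlgebra.contractLeft_ι_mul φ v y
    rw [key]
    refine sub_mem (Submodule.smul_mem _ _ hy) ?_
    cases n with
    | zero =>
      rw [pow_zero, Submodule.mem_one] at hy
      obtain ⟨s, rfl⟩ := hy
      have : CliffordAlgebra.contractLeft (Q := (0 : QuadraticForm R V)) φ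
        (algebraMap R (ExteriorAlgebra R V) s) = 0 := CliffordAlgebra.contractLeft_algebraMap _ φ s
      rw [this, mul_zero]
      exact zero_mem _
    | succ n =>
      rw [ExteriorAlgebra.exteriorPower, pow_succ']
      exact Submodule.mul_mem_mul (LinearMap.mem_range_self _ v)
        (contractLeft_mem_exteriorPower φ n y hy)

/-- Contraction with a linear form, as a map `⋀^(n+1) V → ⋀^n V`. -/
def contractMap (φ : Module.Dual R V) (n : ℕ) : ⋀[R]^(n + 1) V →ₗ[R] ⋀[R]^n V :=
  LinearMap.restrict (CliffordAlgebra.contractLeft (Q := (0 : QuadraticForm R V)) φ)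
    (contractLeft_mem_exteriorPower R φ n)

lemma contractMap_wedgeMap_zero (φ : Module.Dual R V) (v : V) (ω : ⋀[R]^0 V) :
    contractMap R φ 0 (wedgeMap R v 0 ω) = φ v • ω := by
  obtain ⟨ω, hω⟩ := ω
  obtain ⟨s, rfl⟩ := Submodule.mem_one.1 (by simpa using hω)
  apply Subtype.ext
  change CliffordAlgebra.contractLeft (Q := (0 : QuadraticForm R V)) φ
    (CliffordAlgebra.ι _ v * algebraMap R (CliffordAlgebra (0 : QuadraticForm R V)) s) =
      φ v • algebraMap R (CliffordAlgebra (0 : QuadraticForm R V)) s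
  rw [CliffordAlgebra.contractLeft_ι_mul, CliffordAlgebra.contractLeft_algebraMap, mul_zero,
    sub_zero]

lemma contractMap_wedgeMap (φ : Module.Dual R V) (v : V) (n : ℕ) (ω : ⋀[R]^(n + 1) V) :
    contractMap R φ (n + 1) (wedgeMap R v (n + 1) ω) =
      φ v • ω - wedgeMap R v n (contractMap R φ n ω) :=
  Subtype.ext (CliffordAlgebra.contractLeft_ι_mul (Q := (0 : QuadraticForm R V)) φ v ω.1)

lemma wedgeMap_wedgeMap (v w : V) (n : ℕ) (ω : ⋀[R]^n V) :
    wedgeMap R v (n + 1) (wedgeMap R w n ω) = - wedgeMap R w (n + 1) (wedgeMap R v n ω) := by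
  apply Subtype.ext
  change ExteriorAlgebra.ι R v * (ExteriorAlgebra.ι R w * (ω : ExteriorAlgebra R V)) =
    -(ExteriorAlgebra.ι R w * (ExteriorAlgebra.ι R v * (ω : ExteriorAlgebra R V)))
  rw [← mul_assoc, ← mul_assoc, ← neg_mul,
    eq_neg_of_add_eq_zero_left (ExteriorAlgebra.ι_add_mul_swap v w)]

/-- Euler's formula: `∑ᵢ eᵢ ∧ (eᵢ* ⌟ ω) = deg(ω) ω`. -/
lemma sum_wedgeMap_contractMap {σ : Type*} [Fintype σ] [DecidableEq σ] (n : ℕ)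
    (ω : ⋀[R]^(n + 1) (σ → R)) :
    ∑ i, wedgeMap R (Pi.single i 1) n (contractMap R (LinearMap.proj i) n ω) =
      ((n + 1 : ℕ) : R) • ω := by
  have hv (v : σ → R) (k : ℕ) (y : ⋀[R]^k (σ → R)) :
      ∑ i, v i • wedgeMap R (Pi.single i 1) k y = wedgeMap R v k y := by
    apply Subtype.ext
    simp only [AddSubmonoidClass.coe_finsetSum, Submodule.coe_smul]
    change ∑ i, v i • (ExteriorAlgebra.ι R (Pi.single i (1 : R)) * y.1) =
      ExteriorAlgebra.ι R v * y.1
    conv_rhs => rw [pi_eq_sum_univ' v]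
    simp [Finset.sum_mul]
  obtain ⟨ω, hω⟩ := ω
  have hω' := hω
  rw [ExteriorAlgebra.exteriorPower, pow_succ'] at hω'
  induction hω' using Submodule.mul_induction_on' with
  | add x hx y hy ihx ihy =>
    rw [← pow_succ'] at hx hy
    have := congrArg₂ (· + ·) (ihx hx) (ihy hy)
    simp only [← Finset.sum_add_distrib, ← map_add, ← smul_add] at this
    exact this
  | mem_mul_mem m hm y hy =>
    obtain ⟨v, rfl⟩ := hm
    change ∑ i, wedgeMap R _ n (contractMap R _ n (wedgeMap R v n ⟨y, hy⟩)) =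
      _ • wedgeMap R v n ⟨y, hy⟩
    cases n with
    | zero => simp only [contractMap_wedgeMap_zero, map_smul, LinearMap.proj_apply, hv, zero_add,
        Nat.cast_one, one_smul]
    | succ n =>
      have := sum_wedgeMap_contractMap n ⟨y, hy⟩
      simp only [contractMap_wedgeMap, map_sub, map_smul, Finset.sum_sub_distrib,
        LinearMap.proj_apply, hv, wedgeMap_wedgeMap R _ v]
      rw [Finset.sum_neg_distrib, ← map_sum, this, map_smul, sub_neg_eq_add]
      push_cast
      module

end Contraction

section Koszul

variable {r : ℕ} {X : ℕ → Type*} [∀ n, AddCommGroup (X n)] [∀ n, Module ℂ (X n)]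

/-- The Koszul differential of a family of operators raising the degree. -/
def koszulD (a : ∀ n, Fin r → X n →ₗ[ℂ] X (n + 1)) (n : ℕ) :
    X n ⊗[ℂ] ⋀[ℂ]^n (Fin r → ℂ) →ₗ[ℂ] X (n + 1) ⊗[ℂ] ⋀[ℂ]^(n + 1) (Fin r → ℂ) :=
  ∑ i, TensorProduct.map (a n i) (wedgeMap ℂ (Pi.single i 1) n)

/-- The Koszul homotopy of a family of operators lowering the degree. -/
def koszulH (b : ∀ n, Fin r → X (n + 1) →ₗ[ℂ] X n) (n : ℕ) :
    X (n + 1) ⊗[ℂ] ⋀[ℂ]^(n + 1) (Fin r → ℂ) →ₗ[ℂ] X n ⊗[ℂ] ⋀[ℂ]^n (Fin r → ℂ) :=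
  ∑ i, TensorProduct.map (b n i) (contractMap ℂ (LinearMap.proj i) n)

lemma koszulD_koszulD {a : ∀ n, Fin r → X n →ₗ[ℂ] X (n + 1)}
    (ha : ∀ n i j x, a (n + 1) i (a n j x) = a (n + 1) j (a n i x)) (n : ℕ)
    (z : X n ⊗[ℂ] ⋀[ℂ]^n (Fin r → ℂ)) : koszulD a (n + 1) (koszulD a n z) = 0 := by
  induction z with
  | zero => simp
  | add x y hx hy => rw [map_add, map_add, hx, hy, add_zero]
  | tmul x ω =>
    simp only [koszulD, LinearMap.sum_apply, map_tmul, map_sum]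
    refine (smul_eq_zero_iff_right (two_ne_zero' ℂ)).1 ?_
    rw [two_smul, ← eq_neg_iff_add_eq_zero]
    conv_lhs => rw [Finset.sum_comm]
    simp only [← Finset.sum_neg_distrib]
    refine Finset.sum_congr rfl fun i _ => Finset.sum_congr rfl fun j _ => ?_
    rw [ha, wedgeMap_wedgeMap, tmul_neg]

lemma koszulH_koszulD_zero (a : ∀ n, Fin r → X n →ₗ[ℂ] X (n + 1))
    (b : ∀ n, Fin r → X (n + 1) →ₗ[ℂ] X n) :
    koszulH b 0 ∘ₗ koszulD a 0 = (∑ i, b 0 i ∘ₗ a 0 i).rTensor _ := by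
  refine TensorProduct.ext' fun x ω => ?_
  simp [koszulD, koszulH, contractMap_wedgeMap_zero, Pi.single_apply, sum_tmul, ite_smul, tmul_ite]

lemma koszulH_koszulD_succ (a : ∀ n, Fin r → X n →ₗ[ℂ] X (n + 1))
    (b : ∀ n, Fin r → X (n + 1) →ₗ[ℂ] X n) {ε : ℂ}
    (hab : ∀ n i j x, b (n + 1) j (a (n + 1) i x) - a n i (b n j x) = if i = j then ε • x else 0)
    (n : ℕ) :
    koszulH b (n + 1) ∘ₗ koszulD a (n + 1) + koszulD a n ∘ₗ koszulH b n =
      (∑ i, b (n + 1) i ∘ₗ a (n + 1) i).rTensor _ + (-(ε * ((n + 1 : ℕ) : ℂ))) • 1 := by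
  refine TensorProduct.ext' fun x ω => ?_
  have hE := congrArg (x ⊗ₜ[ℂ] ·) (sum_wedgeMap_contractMap ℂ n ω)
  simp only [tmul_sum, tmul_smul] at hE
  have hab' (i j) : a n i (b n j x) =
      b (n + 1) j (a (n + 1) i x) - if i = j then ε • x else 0 := by rw [← hab n i j x]; abel
  simp only [koszulD, koszulH, LinearMap.add_apply, LinearMap.comp_apply, LinearMap.sum_apply,
    map_tmul, map_sum, LinearMap.rTensor_tmul, sum_tmul, LinearMap.smul_apply,
    Module.End.one_apply, contractMap_wedgeMap, hab', tmul_sub, sub_tmul, Finset.sum_sub_distrib,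
    LinearMap.proj_apply, Pi.single_apply, ite_smul, one_smul, zero_smul, tmul_ite,
    ite_tmul, neg_smul, mul_smul, ← hE]
  rw [Finset.sum_comm (f := fun i j => b (n + 1) i (a (n + 1) j x) ⊗ₜ[ℂ]
    (wedgeMap ℂ (Pi.single j 1) n) (contractMap ℂ (LinearMap.proj i) n ω))]
  simp [smul_tmul', Finset.smul_sum]
  abel

open Module.End in
/-- Exactness of the Koszul complex of operators `a` which admit operators `b` with
`[b_j, a_i] = ε δ_{ij}` such that `∑ b_i a_i` has the only generalized eigenvalue `c + ε n` in
degree `n`, where `c ≠ 0`. -/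
lemma koszulD_exact {a : ∀ n, Fin r → X n →ₗ[ℂ] X (n + 1)}
    (b : ∀ n, Fin r → X (n + 1) →ₗ[ℂ] X n) {ε c : ℂ} (hc : c ≠ 0)
    (ha : ∀ n i j x, a (n + 1) i (a n j x) = a (n + 1) j (a n i x))
    (hab : ∀ n i j x, b (n + 1) j (a (n + 1) i x) - a n i (b n j x) = if i = j then ε • x else 0)
    (hL : ∀ n x, x ∈ maxGenEigenspace (∑ i, b n i ∘ₗ a n i : Module.End ℂ (X n)) (c + ε * n)) :
    LinearMap.ker (koszulD a 0) = ⊥ ∧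
      ∀ n, LinearMap.ker (koszulD a (n + 1)) = LinearMap.range (koszulD a n) := by
  refine exact_of_homotopy (koszulD a) (koszulH b) (koszulD_koszulD ha) hc (fun z => ?_)
    fun n z => ?_
  · rw [koszulH_koszulD_zero]
    exact mem_maxGenEigenspace_rTensor (by simpa using hL 0) z
  · rw [mem_maxGenEigenspace_add_smul_one (koszulH_koszulD_succ a b hab n)
      (b := c + ε * (n + 1 : ℕ)) (by ring)]
    exact mem_maxGenEigenspace_rTensor (hL (n + 1)) z

end Koszul

/-- Let `M` be a complex vector space with a monodromic structure of
rank `r`: a rank-`r` Weyl system `t_1, …, t_r, ∂_1, …, ∂_r` together with a direct sum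
decomposition `M = ⊕_{χ ∈ ℚ} M^χ` with `tᵢ(M^χ) ⊆ M^{χ+1}`, `∂ᵢ(M^χ) ⊆ M^{χ-1}` and
`θ - χ + r` locally nilpotent on `M^χ` where `θ = Σᵢ tᵢ∘∂ᵢ`.  Then for every rational
`χ ≠ 0` both of the following Koszul-type complexes are exact:
(a) `ℓ`-th term `M^{χ+ℓ} ⊗ Λ^ℓ(ℂ^r)`, differential `m ⊗ ω ↦ Σᵢ tᵢ(m) ⊗ (eᵢ ∧ ω)`;
(b) `ℓ`-th term `M^{χ+r-ℓ} ⊗ Λ^ℓ(ℂ^r)`, differential `m ⊗ ω ↦ Σᵢ ∂ᵢ(m) ⊗ (eᵢ ∧ ω)`.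
Exactness is expressed as injectivity of the leftmost map together with
`ker (δ (n+1)) = range (δ n)` for all `n` (which at `n = r-1` is surjectivity onto the
rightmost term, the terms beyond the `r`-th being zero). -/
theorem statement4 (r : ℕ) (hr : 1 ≤ r)
    (M : Type*) [AddCommGroup M] [Module ℂ M]
    (t d : Fin r → Module.End ℂ M)
    (htt : ∀ i j, t i * t j = t j * t i)
    (hdd : ∀ i j, d i * d j = d j * d i)
    (hdt : ∀ i j, d i * t j - t j * d i = if i = j then 1 else 0)
    (θ : Module.End ℂ M) (hθ : θ = ∑ i, t i * d i)
    (Mc : ℚ → Submodule ℂ M)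
    (hint : DirectSum.IsInternal Mc)
    (hMt : ∀ (i : Fin r) (χ : ℚ), ∀ m ∈ Mc χ, t i m ∈ Mc (χ + 1))
    (hMd : ∀ (i : Fin r) (χ : ℚ), ∀ m ∈ Mc χ, d i m ∈ Mc (χ - 1))
    (hMnil : ∀ (χ : ℚ), ∀ m ∈ Mc χ, ∃ k : ℕ,
      (((θ - ((χ : ℂ) - (r : ℂ)) • 1) ^ k) m = 0)) :
    ∀ (χ : ℚ), χ ≠ 0 →
      (∀ (T : ∀ (n : ℕ), Fin r → (Mc (χ + n) →ₗ[ℂ] Mc (χ + (n + 1 : ℕ)))),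
        (∀ (n : ℕ) (i : Fin r) (m : M) (hm : m ∈ Mc (χ + n))
            (hm' : t i m ∈ Mc (χ + (n + 1 : ℕ))), T n i ⟨m, hm⟩ = ⟨t i m, hm'⟩) →
        ∀ (δ : ∀ n : ℕ, (Mc (χ + n) ⊗[ℂ] ⋀[ℂ]^n (Fin r → ℂ)) →ₗ[ℂ]
            (Mc (χ + (n + 1 : ℕ)) ⊗[ℂ] ⋀[ℂ]^(n+1) (Fin r → ℂ))),
          (∀ (n : ℕ) (x : Mc (χ + n)) (ω : ⋀[ℂ]^n (Fin r → ℂ)),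
            δ n (x ⊗ₜ[ℂ] ω) = ∑ i, (T n i x) ⊗ₜ[ℂ] (wedgeMap ℂ (Pi.single i 1) n ω)) →
          (LinearMap.ker (δ 0) = ⊥ ∧
            ∀ n : ℕ, LinearMap.ker (δ (n+1)) = LinearMap.range (δ n))) ∧
      (∀ (D : ∀ (n : ℕ), Fin r → (Mc (χ + r - n) →ₗ[ℂ] Mc (χ + r - (n + 1 : ℕ)))),
        (∀ (n : ℕ) (i : Fin r) (m : M) (hm : m ∈ Mc (χ + r - n))
            (hm' : d i m ∈ Mc (χ + r - (n + 1 : ℕ))), D n i ⟨m, hm⟩ = ⟨d i m, hm'⟩) →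
        ∀ (δ : ∀ n : ℕ, (Mc (χ + r - n) ⊗[ℂ] ⋀[ℂ]^n (Fin r → ℂ)) →ₗ[ℂ]
            (Mc (χ + r - (n + 1 : ℕ)) ⊗[ℂ] ⋀[ℂ]^(n+1) (Fin r → ℂ))),
          (∀ (n : ℕ) (x : Mc (χ + r - n)) (ω : ⋀[ℂ]^n (Fin r → ℂ)),
            δ n (x ⊗ₜ[ℂ] ω) = ∑ i, (D n i x) ⊗ₜ[ℂ] (wedgeMap ℂ (Pi.single i 1) n ω)) →
          (LinearMap.ker (δ 0) = ⊥ ∧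
            ∀ n : ℕ, LinearMap.ker (δ (n+1)) = LinearMap.range (δ n))) := by
  have hdt' (i j) (x : M) : d i (t j x) - t j (d i x) = if i = j then x else 0 := by
    have := congrArg (· x) (hdt i j)
    split_ifs at this ⊢ with h <;> simpa [h] using this
  have hθ' : ∑ i, d i * t i = θ + (r : ℂ) • 1 := by
    have (i : Fin r) : d i * t i = t i * d i + 1 := by
      rw [← sub_eq_iff_eq_add', hdt, if_pos rfl]
    simp [this, Finset.sum_add_distrib, hθ, Nat.cast_smul_eq_nsmul]
  have hnil (χ : ℚ) (m : M) (hm : m ∈ Mc χ) :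
      m ∈ Module.End.maxGenEigenspace θ ((χ : ℂ) - r) :=
    (Module.End.mem_maxGenEigenspace _ _ _).2 (hMnil χ m hm)
  intro χ hχ
  have hχ' : (χ : ℂ) ≠ 0 := by exact_mod_cast hχ
  constructor
  · intro T hT δ hδ
    have hTv (n i x) : (T n i x : M) = t i x := by
      have h := hMt i _ x x.2
      rw [show χ + n + 1 = χ + (n + 1 : ℕ) by push_cast; ring] at h
      exact congrArg Subtype.val (hT n i x x.2 h)
    let b (n : ℕ) (i : Fin r) : Mc (χ + (n + 1 : ℕ)) →ₗ[ℂ] Mc (χ + n) :=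
      (d i).restrict fun m hm => by
        have h := hMd i _ m hm
        rwa [show χ + (n + 1 : ℕ) - 1 = χ + n by push_cast; ring] at h
    have hb (n i x) : (b n i x : M) = d i x := rfl
    obtain rfl : δ = koszulD (X := fun n => Mc (χ + n)) T := by
      funext n
      refine TensorProduct.ext' fun x ω => ?_
      simp [hδ, koszulD]
    refine koszulD_exact (X := fun n => Mc (χ + n)) b (ε := 1) hχ' (fun n i j x => ?_)
      (fun n i j x => ?_) fun n x => ?_
    · apply Subtype.ext
      simpa only [hTv, Module.End.mul_apply] using LinearMap.congr_fun (htt i j) (x : M)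
    · apply Subtype.ext
      rw [Submodule.coe_sub, hb, hTv, hTv, hb, hdt']
      split_ifs <;> simp_all
    · refine mem_maxGenEigenspace_of_intertwine (ι := (Mc (χ + n)).subtype)
        (g := ∑ i, d i * t i) (Submodule.subtype_injective _) (fun y => ?_) ?_
      · simp [hb, hTv]
      · rw [mem_maxGenEigenspace_add_smul_one hθ' (b := ((χ + n : ℚ) : ℂ) - r)
          (by push_cast; ring)]
        exact hnil _ _ x.2
  · intro D hD δ hδ
    have hDv (n i x) : (D n i x : M) = d i x := by
      have h := hMd i _ x x.2
      rw [show χ + r - n - 1 = χ + r - (n + 1 : ℕ) by push_cast; ring] at h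
      exact congrArg Subtype.val (hD n i x x.2 h)
    let b (n : ℕ) (i : Fin r) : Mc (χ + r - (n + 1 : ℕ)) →ₗ[ℂ] Mc (χ + r - n) :=
      (t i).restrict fun m hm => by
        have h := hMt i _ m hm
        rwa [show χ + r - (n + 1 : ℕ) + 1 = χ + r - n by push_cast; ring] at h
    have hb (n i x) : (b n i x : M) = t i x := rfl
    obtain rfl : δ = koszulD (X := fun n => Mc (χ + r - n)) D := by
      funext n
      refine TensorProduct.ext' fun x ω => ?_
      simp [hδ, koszulD]
    refine koszulD_exact (X := fun n => Mc (χ + r - n)) b (ε := -1) hχ' (fun n i j x => ?_)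
      (fun n i j x => ?_) fun n x => ?_
    · apply Subtype.ext
      simpa only [hDv, Module.End.mul_apply] using LinearMap.congr_fun (hdd i j) (x : M)
    · apply Subtype.ext
      rw [Submodule.coe_sub, hb, hDv, hDv, hb, ← neg_sub, hdt']
      split_ifs <;> simp_all
    · refine mem_maxGenEigenspace_of_intertwine (ι := (Mc (χ + r - n)).subtype)
        (g := θ) (Submodule.subtype_injective _) (fun y => ?_) ?_
      · simp [hb, hDv, hθ]
      · rw [show (χ : ℂ) + -1 * n = ((χ + r - n : ℚ) : ℂ) - r by push_cast; ring]
        exact hnil _ _ x.2
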